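/- Fix β, M > 0 and d > 0. Let μ be a probability measure on [0,1]^D such that there exists C > 0 with N(ε, supp(μ), ‖·‖_∞) ≤ C·ε^{−d} for all sufficiently small ε > 0, and such that supp(μ) satisfies the Concentration Condition. Then there exist constants C' > 0 and ε₀ > 0 such that for all ε ∈ (0, ε₀), log N(ε, H(β,[0,1]^D,M), ‖·‖_{L^∞(μ)}) ≤ C'·ε^{−d/β}. -/

import Mathlib

open MeasureTheory ProbabilityTheory Filter Matrix

noncomputable section

/-- Smallest number of closed `ℓ∞`-balls of radius `ε` needed to cover `E`
(the norm on `Fin D → ℝ` is the sup norm). -/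
def coverNum {D : ℕ} (E : Set (Fin D → ℝ)) (ε : ℝ) : ℕ :=
  sInf {n : ℕ | ∃ s : Finset (Fin D → ℝ), s.card = n ∧ E ⊆ ⋃ x ∈ s, Metric.closedBall x ε}

/-- Upper Minkowski dimension of a set `E ⊆ ℝ^D`. -/
def minkowskiDim {D : ℕ} (E : Set (Fin D → ℝ)) : ℝ :=
  sInf {d : ℝ | 0 ≤ d ∧
    Filter.limsup (fun ε : ℝ => (coverNum E ε : ℝ) * ε ^ d) (nhdsWithin 0 (Set.Ioi 0)) = 0}

/-- Support of a measure: points all of whose neighborhoods have positive measure. -/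
def measSupport {D : ℕ} (μ : Measure (Fin D → ℝ)) : Set (Fin D → ℝ) :=
  {x | ∀ U ∈ nhds x, 0 < μ U}

/-- The unit cube `[0,1]^D`. -/
def unitCube (D : ℕ) : Set (Fin D → ℝ) := Set.univ.pi fun _ => Set.Icc (0:ℝ) 1

/-- The largest integer strictly smaller than `β`. -/
def hFloor (β : ℝ) : ℕ := ⌈β⌉₊ - 1

/-- Partial derivative in the `j`-th coordinate direction. -/
def pderiv1 {D : ℕ} (j : Fin D) (f : (Fin D → ℝ) → ℝ) : (Fin D → ℝ) → ℝ :=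
  fun x => fderiv ℝ f x (Pi.single j 1)

/-- Iterated partial derivative in the `j`-th direction. -/
def pderivIter {D : ℕ} (j : Fin D) : ℕ → ((Fin D → ℝ) → ℝ) → ((Fin D → ℝ) → ℝ)
  | 0 => id
  | n + 1 => fun f => pderiv1 j (pderivIter j n f)

/-- Multi-index partial derivative `∂^α f`. -/
def mDeriv {D : ℕ} (α : Fin D → ℕ) (f : (Fin D → ℝ) → ℝ) : (Fin D → ℝ) → ℝ :=
  (List.ofFn fun j : Fin D => pderivIter j (α j)).foldr (fun op g => op g) f

/-- The Hölder ball `H(β, [0,1]^D, M)`. -/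
def holderBall (D : ℕ) (β M : ℝ) : Set ((Fin D → ℝ) → ℝ) :=
  {f | ContDiffOn ℝ (hFloor β : ℕ∞) f (unitCube D) ∧
    ∃ M₁ M₂ : ℝ, 0 ≤ M₁ ∧ 0 ≤ M₂ ∧ M₁ + M₂ ≤ M ∧
      (∀ α : Fin D → ℕ, (∑ j, α j) < hFloor β →
        ∀ x ∈ unitCube D, |mDeriv α f x| ≤ M₁) ∧
      (∀ α : Fin D → ℕ, (∑ j, α j) = hFloor β →
        ∀ x ∈ unitCube D, ∀ y ∈ unitCube D, x ≠ y →
          |mDeriv α f x - mDeriv α f y| ≤ M₂ * ‖x - y‖ ^ (β - (hFloor β : ℝ)))}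

/-- A ReLU neural-network architecture with `Lm + 1` layers; layer `ℓ` (for
`0 ≤ ℓ ≤ Lm`) is the affine map `v ↦ A ℓ *ᵥ v + b ℓ` from width `p ℓ` to width
`p (ℓ+1)`; ReLU is applied after every layer except the last. -/
structure NeuralNet where
  Lm : ℕ
  p : ℕ → ℕ
  A : ∀ ℓ : ℕ, Matrix (Fin (p (ℓ + 1))) (Fin (p ℓ)) ℝ
  b : ∀ ℓ : ℕ, Fin (p (ℓ + 1)) → ℝ

namespace NeuralNet

/-- Number of layers `L(Φ)`. -/
def depth (Φ : NeuralNet) : ℕ := Φ.Lm + 1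

/-- Hidden activations. -/
def hidden (Φ : NeuralNet) : (ℓ : ℕ) → (Fin (Φ.p 0) → ℝ) → (Fin (Φ.p ℓ) → ℝ)
  | 0, x => x
  | ℓ + 1, x => fun i => max ((Φ.A ℓ *ᵥ Φ.hidden ℓ x + Φ.b ℓ) i) 0

/-- Realization `R(Φ)` of the network. -/
def realize (Φ : NeuralNet) (x : Fin (Φ.p 0) → ℝ) : Fin (Φ.p (Φ.Lm + 1)) → ℝ :=
  Φ.A Φ.Lm *ᵥ Φ.hidden Φ.Lm x + Φ.b Φ.Lm

/-- `W(Φ)`: the number of nonzero parameters. -/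
def numParams (Φ : NeuralNet) : ℕ :=
  ∑ ℓ ∈ Finset.range (Φ.Lm + 1),
    ({ij : Fin (Φ.p (ℓ + 1)) × Fin (Φ.p ℓ) | Φ.A ℓ ij.1 ij.2 ≠ 0}.ncard
      + {i : Fin (Φ.p (ℓ + 1)) | Φ.b ℓ i ≠ 0}.ncard)

/-- `B(Φ)`: the maximal absolute value of the parameters. -/
def maxParam (Φ : NeuralNet) : ℝ :=
  sSup {r : ℝ | ∃ ℓ ≤ Φ.Lm, (∃ i j, r = |Φ.A ℓ i j|) ∨ ∃ i, r = |Φ.b ℓ i|}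

end NeuralNet

/-- `F(W, L, B)`: realizations of networks with input dimension `D`, output
dimension 1, at most `W` nonzero parameters, at most `L` layers, and parameter
magnitudes at most `B`. -/
def NNclass (D : ℕ) (W L B : ℝ) : Set ((Fin D → ℝ) → ℝ) :=
  {f | ∃ (Φ : NeuralNet) (h0 : Φ.p 0 = D) (h1 : Φ.p (Φ.Lm + 1) = 1),
    (Φ.numParams : ℝ) ≤ W ∧ (Φ.depth : ℝ) ≤ L ∧ Φ.maxParam ≤ B ∧
    ∀ x : Fin D → ℝ, f x = Φ.realize (fun i => x (Fin.cast h0 i)) (Fin.cast h1.symm 0)}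

/-- Version of `F(W, L, B)` with `m`-dimensional output. -/
def NNclassM (D m : ℕ) (W L B : ℝ) : Set ((Fin D → ℝ) → Fin m → ℝ) :=
  {f | ∃ (Φ : NeuralNet) (h0 : Φ.p 0 = D) (h1 : Φ.p (Φ.Lm + 1) = m),
    (Φ.numParams : ℝ) ≤ W ∧ (Φ.depth : ℝ) ≤ L ∧ Φ.maxParam ≤ B ∧
    ∀ (x : Fin D → ℝ) (i : Fin m),
      f x i = Φ.realize (fun j => x (Fin.cast h0 j)) (Fin.cast h1.symm i)}

/-- Covering number of a class of functions w.r.t. the `L^∞(μ)` norm. -/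
def funCoverNum {D : ℕ} (ε : ℝ) (F : Set ((Fin D → ℝ) → ℝ)) (μ : Measure (Fin D → ℝ)) : ℕ :=
  sInf {n : ℕ | ∃ s : Finset ((Fin D → ℝ) → ℝ), s.card = n ∧
    ∀ f ∈ F, ∃ g ∈ s, ∀ᵐ x ∂μ, |f x - g x| ≤ ε}

/-- The (upper) regularity dimension of a measure `ν` on `X`. -/
def regularityDim {D : ℕ} (X : Set (Fin D → ℝ)) (ν : Measure (Fin D → ℝ)) : ℝ :=
  sInf {d : ℝ | 0 < d ∧ ∃ C : ℝ, 0 < C ∧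
    ∀ x ∈ measSupport ν, ∀ ε ∈ Set.Ioo (0:ℝ) 1, ∀ r : ℝ, 0 < r →
      ν (Metric.closedBall x r ∩ X) ≤
        ENNReal.ofReal (C * ε ^ (-d)) * ν (Metric.closedBall x (ε * r) ∩ X)}

/-- Distance between two sets (w.r.t. the sup norm). -/
def setDist {D : ℕ} (A B : Set (Fin D → ℝ)) : ℝ :=
  sInf {r : ℝ | ∃ x ∈ A, ∃ y ∈ B, r = ‖x - y‖}

/-- The closed axis-aligned hypercube with lower corner `a` and side length `γ`. -/
def cornerCube {D : ℕ} (a : Fin D → ℝ) (γ : ℝ) : Set (Fin D → ℝ) :=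
  Set.univ.pi fun ℓ => Set.Icc (a ℓ) (a ℓ + γ)

/-- The closed axis-aligned hypercube with center `ι` and side length `γ`. -/
def centerCube {D : ℕ} (ι : Fin D → ℝ) (γ : ℝ) : Set (Fin D → ℝ) :=
  Set.univ.pi fun ℓ => Set.Icc (ι ℓ - γ / 2) (ι ℓ + γ / 2)

/-- `I ⊕ r`: the union of open `ℓ∞`-balls of radius `r` centered in `I`. -/
def expandSet {D : ℕ} (I : Set (Fin D → ℝ)) (r : ℝ) : Set (Fin D → ℝ) :=
  ⋃ z ∈ I, Metric.ball z r

/-- The Concentration Condition for a set `E ⊆ ℝ^K`. -/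
def ConcentrationCondition {K : ℕ} (E : Set (Fin K → ℝ)) : Prop :=
  ∃ C₁ C₂ : ℝ, 0 < C₁ ∧ 0 < C₂ ∧
    ∀ ε : ℝ, 0 < ε → ∃ (T U : ℕ) (x : Fin T → (Fin K → ℝ)) (g : Fin T → Fin U),
      E ⊆ ⋃ i, Metric.closedBall (x i) ε ∧
      (∀ j : Fin U, ∀ X : Finset (Fin T), (∀ i ∈ X, g i = j) → X.Nonempty →
        X ≠ Finset.univ.filter (fun i => g i = j) →
        ∃ i, g i = j ∧ i ∉ X ∧ ∃ k ∈ X, ‖x k - x i‖ ≤ ε) ∧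
      (T : ℝ) ≤ C₁ * coverNum E ε ∧
      (U : ℝ) * Real.log (1 / ε) ≤ C₂ * coverNum E ε

/-- Smallest number of closed Euclidean (`ℓ²`) balls of radius `ε` needed to cover `E`. -/
def coverNum2 {D : ℕ} (E : Set (Fin D → ℝ)) (ε : ℝ) : ℕ :=
  sInf {n : ℕ | ∃ s : Finset (Fin D → ℝ), s.card = n ∧
    E ⊆ ⋃ x ∈ s, {y | Real.sqrt (∑ j, (y j - x j) ^ 2) ≤ ε}}

end

lemma exists_code_of_chain_connected {F A : Type*} {T U : ℕ} (g : Fin T → Fin U)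
    (adj : Fin T → Fin T → Prop)
    (hconn : ∀ j : Fin U, ∀ X : Finset (Fin T), (∀ i ∈ X, g i = j) → X.Nonempty →
      X ≠ Finset.univ.filter (fun i => g i = j) → ∃ i, g i = j ∧ i ∉ X ∧ ∃ k ∈ X, adj k i)
    (σ : F → Fin T → A) (κ₀ κ₁ : Type) [Fintype κ₀] [Fintype κ₁] [Nonempty κ₀] [Nonempty κ₁]
    (ρ₀ : Fin T → F → κ₀) (hρ₀ : ∀ i f f', ρ₀ i f = ρ₀ i f' → σ f i = σ f' i)
    (ρ₁ : Fin T → Fin T → F → κ₁)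
    (hρ₁ : ∀ k i, adj k i → ∀ f f', σ f k = σ f' k → ρ₁ k i f = ρ₁ k i f' → σ f i = σ f' i) :
    ∃ (κ : Type) (_ : Fintype κ) (code : F → κ),
      Fintype.card κ ≤ Fintype.card κ₀ ^ U * Fintype.card κ₁ ^ T ∧
      ∀ f f', code f = code f' → σ f = σ f' := by
  classical
  let P : Finset (Fin T) → Prop := fun X => ∃ (κ : Type) (_ : Fintype κ) (code : F → κ),
    Fintype.card κ ≤ Fintype.card κ₀ ^ (X.image g).card * Fintype.card κ₁ ^ X.card ∧
      ∀ f f', code f = code f' → ∀ i ∈ X, σ f i = σ f' i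
  have hP : P ∅ := ⟨Unit, inferInstance, fun _ => (), by simp, by simp⟩
  obtain ⟨X, hX, hmax⟩ := (Set.toFinite {X | P X}).exists_maximal ⟨∅, hP⟩
  have hκ₁ : 1 ≤ Fintype.card κ₁ := Fintype.card_pos
  have huniv : X = Finset.univ := by
    by_contra hne
    obtain ⟨i, hi⟩ : ∃ i, i ∉ X := by
      by_contra! h
      exact hne (Finset.eq_univ_iff_forall.2 h)
    obtain ⟨κ, _, code, hcard, hcode⟩ := hX
    suffices ∃ i ∉ X, P (insert i X) by
      obtain ⟨i, hi, hPi⟩ := this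
      exact hi (hmax hPi (Finset.subset_insert i X) (Finset.mem_insert_self i X))
    by_cases hj : ∃ k ∈ X, g k = g i
    · obtain ⟨k₀, hk₀, hgk₀⟩ := hj
      obtain ⟨i', hi', hi'X, k, hk, hadj⟩ := hconn (g i) (X.filter fun k => g k = g i)
        (by simp) ⟨k₀, by simp [hk₀, hgk₀]⟩ (by
          intro h
          have : i ∈ Finset.univ.filter (fun k => g k = g i) := by simp
          rw [← h] at this
          exact hi (Finset.mem_filter.1 this).1)
      have hi'X' : i' ∉ X := fun h => hi'X (by simp [h, hi'])
      refine ⟨i', hi'X', κ × κ₁, inferInstance, fun f => (code f, ρ₁ k i' f), ?_, ?_⟩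
      · have him : (insert i' X).image g = X.image g := by
          rw [Finset.image_insert, Finset.insert_eq_of_mem]
          exact Finset.mem_image.2 ⟨k₀, hk₀, by rw [hgk₀, hi']⟩
        rw [him, Finset.card_insert_of_notMem hi'X', Fintype.card_prod, pow_succ, ← mul_assoc]
        gcongr
      · intro f f' h l hl
        obtain ⟨h1, h2⟩ := Prod.mk.inj h
        rcases Finset.mem_insert.1 hl with rfl | hl
        · exact hρ₁ k _ hadj f f' (hcode f f' h1 k (Finset.mem_filter.1 hk).1) h2
        · exact hcode f f' h1 l hl
    · refine ⟨i, hi, κ × κ₀, inferInstance, fun f => (code f, ρ₀ i f), ?_, ?_⟩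
      · have him : g i ∉ X.image g := by
          intro h
          obtain ⟨k, hk, hgk⟩ := Finset.mem_image.1 h
          exact hj ⟨k, hk, hgk⟩
        rw [Finset.image_insert, Finset.card_insert_of_notMem him,
          Finset.card_insert_of_notMem hi, Fintype.card_prod]
        calc Fintype.card κ * Fintype.card κ₀
            ≤ (Fintype.card κ₀ ^ (X.image g).card * Fintype.card κ₁ ^ X.card)
                * Fintype.card κ₀ := by gcongr
          _ = Fintype.card κ₀ ^ ((X.image g).card + 1) * Fintype.card κ₁ ^ X.card := by ring
          _ ≤ _ := by gcongr; omega
      · intro f f' h l hl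
        obtain ⟨h1, h2⟩ := Prod.mk.inj h
        rcases Finset.mem_insert.1 hl with rfl | hl
        · exact hρ₀ _ f f' h2
        · exact hcode f f' h1 l hl
  obtain ⟨κ, inst, code, hcard, hcode⟩ := hX
  refine ⟨κ, inst, code, hcard.trans ?_,
    fun f f' h => funext fun i => hcode f f' h i (by simp [huniv])⟩
  have hκ₀ : 1 ≤ Fintype.card κ₀ := Fintype.card_pos
  gcongr
  · simpa using Finset.card_le_univ (X.image g)
  · simpa using Finset.card_le_univ X

/-- Entropy of a family of functions that can be predicted from nearby samples. -/
lemma exists_code_of_local_prediction {X : Type*} {ι : Type} [Fintype ι] (F : Set (X → ℝ)) {T U : ℕ}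
    (g : Fin T → Fin U) (adj : Fin T → Fin T → Prop)
    (hconn : ∀ j : Fin U, ∀ S : Finset (Fin T), (∀ i ∈ S, g i = j) → S.Nonempty →
      S ≠ Finset.univ.filter (fun i => g i = j) → ∃ i, g i = j ∧ i ∉ S ∧ ∃ k ∈ S, adj k i)
    (z : Fin T → ι → X) (I : Fin T → (X → ℝ) → X → ℝ) (near : Fin T → X → Prop)
    (q Λ K : ℝ) (hq : 0 < q) (B₀ B₁ : ℕ)
    (hB₀ : ∀ f ∈ F, ∀ i m, |f (z i m)| / q + 1 ≤ B₀) (hB₁ : Λ + K + 2 ≤ B₁)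
    (hstab : ∀ i y, near i y → ∀ (f f' : X → ℝ) (η : ℝ), (∀ m, |f (z i m) - f' (z i m)| ≤ η) →
      |I i f y - I i f' y| ≤ Λ * η)
    (happrox : ∀ f ∈ F, ∀ i y, near i y → |f y - I i f y| ≤ K * q)
    (hnear : ∀ k i, adj k i → ∀ m, near k (z i m)) :
    ∃ (κ : Type) (_ : Fintype κ) (code : F → κ),
      Fintype.card κ ≤ ((2 * B₀ + 1) ^ Fintype.card ι) ^ U * ((2 * B₁ + 1) ^ Fintype.card ι) ^ T ∧
      ∀ f f' : F, code f = code f' → ∀ i y, near i y → |f.1 y - f'.1 y| ≤ (Λ + 2 * K) * q := by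
  classical
  have hfl : ∀ t : ℝ, |t - q * ⌊t / q⌋| ≤ q := by
    intro t
    have h1 := Int.floor_le (t / q)
    have h2 := (Int.lt_floor_add_one (t / q)).le
    rw [le_div_iff₀ hq] at h1
    rw [div_le_iff₀ hq] at h2
    rw [abs_le]
    constructor <;> nlinarith
  have hbox : ∀ B : ℕ, Fintype.card (ι → Finset.Icc (-(B : ℤ)) B)
      = (2 * B + 1) ^ Fintype.card ι := by
    intro B
    simp only [Fintype.card_fun, Fintype.card_coe, Int.card_Icc]
    congr 1
    omega
  let Q : (X → ℝ) → X → ℝ := fun f x => q * ⌊f x / q⌋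
  have hpred : ∀ f ∈ F, ∀ k y, near k y → |f y / q - I k (Q f) y / q| ≤ Λ + K := by
    intro f hf k y hy
    have h1 := happrox f hf k y hy
    have h2 := hstab k y hy f (Q f) q (fun m => hfl _)
    rw [← sub_div, abs_div, abs_of_pos hq, div_le_iff₀ hq]
    calc |f y - I k (Q f) y| ≤ |f y - I k f y| + |I k f y - I k (Q f) y| := abs_sub_le _ _ _
      _ ≤ (Λ + K) * q := by linarith
  have proj : ∀ B : ℕ, ∃ p : ℤ → Finset.Icc (-(B : ℤ)) B, ∀ n : ℤ, |n| ≤ B → (p n : ℤ) = n := by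
    intro B
    refine ⟨fun n => if h : |n| ≤ (B : ℤ) then ⟨n, Finset.mem_Icc.2 (abs_le.1 h)⟩ else
      ⟨0, by simp⟩, fun n hn => by simp [hn]⟩
  obtain ⟨p₀, hp₀⟩ := proj B₀
  obtain ⟨p₁, hp₁⟩ := proj B₁
  have hinj : ∀ {B : ℕ} {p : ℤ → Finset.Icc (-(B : ℤ)) B}, (∀ n : ℤ, |n| ≤ B → (p n : ℤ) = n) →
      ∀ {a b : ℤ}, |a| ≤ B → |b| ≤ B → p a = p b → a = b := by
    intro B p hp a b ha hb h
    rw [← hp a ha, ← hp b hb, h]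
  have hne : ∀ B : ℕ, Nonempty (Finset.Icc (-(B : ℤ)) B) := fun B => ⟨⟨0, by simp⟩⟩
  have := hne B₀
  have := hne B₁
  have hroot : ∀ f ∈ F, ∀ i m, |⌊f (z i m) / q⌋| ≤ (B₀ : ℤ) := by
    intro f hf i m
    have h0 := hB₀ f hf i m
    have h1 := Int.floor_le (f (z i m) / q)
    have h2 := (Int.lt_floor_add_one (f (z i m) / q)).le
    rw [show |f (z i m)| / q = |f (z i m) / q| by rw [abs_div, abs_of_pos hq]] at h0
    have h3 := abs_le.1 (le_sub_iff_add_le.2 h0)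
    rw [← Int.cast_le (R := ℝ)]
    push_cast
    rw [abs_le]
    constructor <;> linarith [h3.1, h3.2]
  have hstep : ∀ f ∈ F, ∀ k i, adj k i → ∀ m,
      |⌊f (z i m) / q⌋ - ⌊I k (Q f) (z i m) / q⌋| ≤ (B₁ : ℤ) := by
    intro f hf k i hki m
    have h0 := abs_le.1 (hpred f hf k _ (hnear k i hki m))
    have h1 := Int.floor_le (f (z i m) / q)
    have h2 := (Int.lt_floor_add_one (f (z i m) / q)).le
    have h3 := Int.floor_le (I k (Q f) (z i m) / q)
    have h4 := (Int.lt_floor_add_one (I k (Q f) (z i m) / q)).le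
    rw [← Int.cast_le (R := ℝ)]
    push_cast
    rw [abs_le]
    constructor <;> linarith [h0.1, h0.2]
  obtain ⟨κ, inst, code, hcard, hcode⟩ := exists_code_of_chain_connected g adj hconn
    (fun (f : F) i m => ⌊f.1 (z i m) / q⌋) (ι → Finset.Icc (-(B₀ : ℤ)) B₀)
    (ι → Finset.Icc (-(B₁ : ℤ)) B₁)
    (fun i f m => p₀ ⌊f.1 (z i m) / q⌋)
    (by
      intro i f f' h
      funext m
      have := congrFun h m
      exact hinj hp₀ (hroot f f.2 i m) (hroot f' f'.2 i m) this)
    (fun k i f m => p₁ (⌊f.1 (z i m) / q⌋ - ⌊I k (Q f.1) (z i m) / q⌋))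
    (by
      intro k i hki f f' hk h
      funext m
      have h1 := congrFun h m
      have h2 := hinj hp₁ (hstep f f.2 k i hki m) (hstep f' f'.2 k i hki m) h1
      have h3 := hstab k (z i m) (hnear k i hki m) (Q f.1) (Q f'.1) 0 (by
        intro m'
        have := congrFun hk m'
        simp [Q, this])
      rw [mul_zero, abs_nonpos_iff, sub_eq_zero] at h3
      rw [h3] at h2
      simpa using h2)
  rw [hbox, hbox] at hcard
  refine ⟨κ, inst, code, hcard, fun f f' h i y hy => ?_⟩
  have hσ := hcode f f' h
  have h1 := happrox f f.2 i y hy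
  have h2 := happrox f' f'.2 i y hy
  have h3 := hstab i y hy f.1 f'.1 q (by
    intro m
    have h4 : ⌊f.1 (z i m) / q⌋ = ⌊f'.1 (z i m) / q⌋ := congrFun (congrFun hσ i) m
    have h5 := (Int.abs_sub_lt_one_of_floor_eq_floor h4).le
    rwa [← sub_div, abs_div, abs_of_pos hq, div_le_one hq] at h5)
  rw [abs_le] at *
  constructor <;> linarith [h1.1, h1.2, h2.1, h2.2, h3.1, h3.2]

lemma Polynomial.exists_derivative_eq (p : Polynomial ℝ) :
    ∃ P : Polynomial ℝ, P.derivative = p ∧ P.natDegree ≤ p.natDegree + 1 := by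
  refine ⟨∑ i ∈ Finset.range (p.natDegree + 1),
    Polynomial.monomial (i + 1) (p.coeff i / ((i : ℝ) + 1)), ?_, ?_⟩
  · conv_rhs => rw [p.as_sum_range]
    rw [Polynomial.derivative_sum]
    refine Finset.sum_congr rfl fun i _ => ?_
    rw [Polynomial.derivative_monomial]
    have : (i : ℝ) + 1 ≠ 0 := by positivity
    push_cast
    rw [div_mul_cancel₀ _ this]
  · refine Polynomial.natDegree_sum_le_of_forall_le _ _ fun i hi => ?_
    refine (Polynomial.natDegree_monomial_le _).trans ?_
    have := Finset.mem_range.1 hi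
    omega

/-- Local polynomial approximation of a function whose `s`-th derivative oscillates by at most
`η`; the functions `φ k` are the successive derivatives of `φ 0`. -/
lemma exists_polynomial_approx {J : Set ℝ} (hJ : Convex ℝ J) {a r η : ℝ} (ha : a ∈ J)
    (hr : ∀ t ∈ J, |t - a| ≤ r) (s : ℕ) (φ : ℕ → ℝ → ℝ)
    (hder : ∀ k < s, ∀ t ∈ J, HasDerivWithinAt (φ k) (φ (k + 1) t) J t)
    (hη : ∀ t ∈ J, |φ s t - φ s a| ≤ η) :
    ∃ p : Polynomial ℝ, p.natDegree ≤ s ∧ ∀ t ∈ J, |φ 0 t - p.eval t| ≤ η * r ^ s := by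
  induction s generalizing φ with
  | zero => exact ⟨Polynomial.C (φ 0 a), by simp, by simpa using hη⟩
  | succ s ih =>
    obtain ⟨p, hp, hpφ⟩ := ih (fun k => φ (k + 1)) (fun k hk => hder (k + 1) (by omega)) hη
    obtain ⟨P, hP, hPdeg⟩ := p.exists_derivative_eq
    refine ⟨P + Polynomial.C (φ 0 a - P.eval a), ?_, fun t ht => ?_⟩
    · rw [Polynomial.natDegree_add_C]
      omega
    · have hd : ∀ x ∈ J, HasDerivWithinAt (fun x => φ 0 x - P.eval x)
          (φ 1 x - p.eval x) J x := fun x hx => by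
        have := (P.hasDerivAt x).hasDerivWithinAt (s := J)
        rw [hP] at this
        exact (hder 0 (by omega) x hx).sub this
      have h := hJ.norm_image_sub_le_of_norm_hasDerivWithin_le hd
        (fun x hx => hpφ x hx) ha ht
      simp only [Real.norm_eq_abs] at h
      have hη0 : 0 ≤ η * r ^ s := (abs_nonneg _).trans (hpφ a ha)
      calc |φ 0 t - (P + Polynomial.C (φ 0 a - P.eval a)).eval t|
          = |φ 0 t - P.eval t - (φ 0 a - P.eval a)| := by
            rw [Polynomial.eval_add, Polynomial.eval_C]
            congr 1
            ring
        _ ≤ η * r ^ s * |t - a| := h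
        _ ≤ η * r ^ s * r := mul_le_mul_of_nonneg_left (hr t ht) hη0
        _ = η * r ^ (s + 1) := by ring

noncomputable section

/-- Weights of Lagrange interpolation at the nodes `0, …, s`. -/
def lagrangeWeight (s m : ℕ) (u : ℝ) : ℝ :=
  (Lagrange.basis (Finset.range (s + 1)) (fun i : ℕ => (i : ℝ)) m).eval u

lemma eval_eq_sum_lagrangeWeight {s : ℕ} {p : Polynomial ℝ} (hp : p.natDegree ≤ s) (c h u : ℝ) :
    p.eval (c + h * u) = ∑ m ∈ Finset.range (s + 1), lagrangeWeight s m u * p.eval (c + h * m) := by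
  set P := p.comp (Polynomial.C c + Polynomial.C h * Polynomial.X) with hP
  have hdeg : P.natDegree ≤ s := by
    refine Polynomial.natDegree_comp_le.trans ?_
    have : (Polynomial.C c + Polynomial.C h * Polynomial.X).natDegree ≤ 1 := by
      compute_degree
    nlinarith
  have h1 : P.degree < (Finset.range (s + 1)).card := by
    rw [Finset.card_range]
    exact (Polynomial.degree_le_of_natDegree_le hdeg).trans_lt
      (by exact_mod_cast Nat.lt_succ_self s)
  have h2 := Lagrange.eq_interpolate (v := fun i : ℕ => (i : ℝ))
    Nat.cast_injective.injOn h1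
  have h3 : ∀ v, P.eval v = p.eval (c + h * v) := fun v => by simp [hP]
  rw [← h3, h2, Lagrange.interpolate_apply, Polynomial.eval_finsetSum]
  refine Finset.sum_congr rfl fun m _ => ?_
  rw [Polynomial.eval_mul, Polynomial.eval_C, h3, lagrangeWeight, mul_comm]

lemma exists_sum_abs_lagrangeWeight_le (s : ℕ) (R : ℝ) :
    ∃ Λ : ℝ, 1 ≤ Λ ∧ ∀ u, |u| ≤ R →
      ∑ m ∈ Finset.range (s + 1), |lagrangeWeight s m u| ≤ Λ := by
  have hc : Continuous fun u => ∑ m ∈ Finset.range (s + 1), |lagrangeWeight s m u| :=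
    continuous_finsetSum _ fun m _ => (Polynomial.continuous _).abs
  obtain ⟨B, hB⟩ := (isCompact_Icc (a := -R) (b := R)).exists_bound_of_continuousOn hc.continuousOn
  exact ⟨max 1 B, le_max_left _ _, fun u hu =>
    (le_abs_self _).trans ((hB u (abs_le.1 hu)).trans (le_max_right _ _))⟩

/-- Lagrange interpolation in the `j`-th coordinate at the nodes `c j + h * m`, `m ≤ s`. -/
def coordInterp {D : ℕ} (s : ℕ) (h : ℝ) (c : Fin D → ℝ) (j : Fin D) (F : (Fin D → ℝ) → ℝ)
    (y : Fin D → ℝ) : ℝ :=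
  ∑ m ∈ Finset.range (s + 1),
    lagrangeWeight s m ((y j - c j) / h) * F (Function.update y j (c j + h * m))

/-- Successive Lagrange interpolation in the coordinates of a list. -/
def tensorInterp {D : ℕ} (s : ℕ) (h : ℝ) (c : Fin D → ℝ) (l : List (Fin D))
    (F : (Fin D → ℝ) → ℝ) : (Fin D → ℝ) → ℝ :=
  l.foldr (coordInterp s h c) F

/-- The open unit cube `(0,1)^D`. -/
def openCube (D : ℕ) : Set (Fin D → ℝ) := Set.univ.pi fun _ => Set.Ioo (0 : ℝ) 1

lemma isOpen_openCube (D : ℕ) : IsOpen (openCube D) :=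
  isOpen_set_pi Set.finite_univ fun _ _ => isOpen_Ioo

lemma openCube_subset_unitCube (D : ℕ) : openCube D ⊆ unitCube D :=
  Set.pi_mono fun _ _ => Set.Ioo_subset_Icc_self

lemma closure_openCube (D : ℕ) : closure (openCube D) = unitCube D := by
  simp [openCube, unitCube, closure_pi_set, closure_Ioo]

lemma abs_sum_mul_le {ι : Type*} (S : Finset ι) (w a : ι → ℝ) {η : ℝ}
    (ha : ∀ i ∈ S, |a i| ≤ η) : |∑ i ∈ S, w i * a i| ≤ (∑ i ∈ S, |w i|) * η := by
  rw [Finset.sum_mul]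
  refine (Finset.abs_sum_le_sum_abs _ _).trans (Finset.sum_le_sum fun i hi => ?_)
  rw [abs_mul]
  exact mul_le_mul_of_nonneg_left (ha i hi) (abs_nonneg _)

section Interpolation

variable {D s : ℕ} {h R Λ : ℝ} {c : Fin D → ℝ}

lemma abs_coordInterp_sub_le (hΛ : ∀ u, |u| ≤ R →
      ∑ m ∈ Finset.range (s + 1), |lagrangeWeight s m u| ≤ Λ) (hh : 0 < h)
    {j : Fin D} {y : Fin D → ℝ} (hy : |y j - c j| ≤ R * h) {F G : (Fin D → ℝ) → ℝ} {η : ℝ}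
    (hFG : ∀ m ∈ Finset.range (s + 1), |F (Function.update y j (c j + h * m))
      - G (Function.update y j (c j + h * m))| ≤ η) :
    |coordInterp s h c j F y - coordInterp s h c j G y| ≤ Λ * η := by
  have hη : 0 ≤ η := (abs_nonneg _).trans (hFG 0 (by simp))
  rw [coordInterp, coordInterp, ← Finset.sum_sub_distrib]
  simp only [← mul_sub]
  refine (abs_sum_mul_le _ _ _ hFG).trans (mul_le_mul_of_nonneg_right (hΛ _ ?_) hη)
  rwa [abs_div, abs_of_pos hh, div_le_iff₀ hh]

lemma abs_tensorInterp_sub_le (hΛ : ∀ u, |u| ≤ R →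
      ∑ m ∈ Finset.range (s + 1), |lagrangeWeight s m u| ≤ Λ) (hh : 0 < h) (hsR : s ≤ R)
    (l : List (Fin D)) {y : Fin D → ℝ} (hy : ∀ j, |y j - c j| ≤ R * h) {F G : (Fin D → ℝ) → ℝ}
    {η : ℝ}
    (hFG : ∀ y' : Fin D → ℝ, (∀ j ∈ l, ∃ m ∈ Finset.range (s + 1), y' j = c j + h * m) →
      (∀ j ∉ l, y' j = y j) → |F y' - G y'| ≤ η) :
    |tensorInterp s h c l F y - tensorInterp s h c l G y| ≤ Λ ^ l.length * η := by
  induction l generalizing y with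
  | nil => simpa [tensorInterp] using hFG y (by simp) (by simp)
  | cons j l ih =>
    rw [List.length_cons, pow_succ', mul_assoc]
    refine abs_coordInterp_sub_le hΛ hh (hy j) fun m hm => ih (fun i => ?_) fun y' h1 h2 => ?_
    · rcases eq_or_ne i j with rfl | hij
      · have hms : (m : ℝ) ≤ s := by exact_mod_cast Nat.lt_succ_iff.1 (Finset.mem_range.1 hm)
        rw [Function.update_self, add_sub_cancel_left, abs_of_nonneg (by positivity), mul_comm]
        gcongr
        exact hms.trans hsR
      · rw [Function.update_of_ne hij]
        exact hy i
    · refine hFG y' (fun i hi => ?_) fun i hi => ?_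
      · by_cases hil : i ∈ l
        · exact h1 i hil
        · obtain rfl : i = j := by simpa [hil] using hi
          exact ⟨m, hm, by rw [h2 i hil, Function.update_self]⟩
      · rw [List.mem_cons, not_or] at hi
        rw [h2 i hi.2, Function.update_of_ne hi.1]

lemma abs_sub_tensorInterp_le (hΛ : ∀ u, |u| ≤ R →
      ∑ m ∈ Finset.range (s + 1), |lagrangeWeight s m u| ≤ Λ) (hΛ1 : 1 ≤ Λ) (hh : 0 < h)
    (hsR : s ≤ R) (hc : ∀ j, ∀ m ∈ Finset.range (s + 1), c j + h * m ∈ Set.Ioo (0 : ℝ) 1)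
    {f : (Fin D → ℝ) → ℝ} {η : ℝ} (hη : 0 ≤ η)
    (hf : ∀ j, ∀ y ∈ openCube D, (∀ j, |y j - c j| ≤ R * h) → |f y - coordInterp s h c j f y| ≤ η)
    (l : List (Fin D)) {y : Fin D → ℝ} (hyO : y ∈ openCube D) (hy : ∀ j, |y j - c j| ≤ R * h) :
    |f y - tensorInterp s h c l f y| ≤ l.length * Λ ^ l.length * η := by
  induction l generalizing y with
  | nil => simp [tensorInterp]
  | cons j l ih =>
    have h1 : |coordInterp s h c j f y - coordInterp s h c j (tensorInterp s h c l f) y|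
        ≤ Λ * (l.length * Λ ^ l.length * η) := by
      refine abs_coordInterp_sub_le hΛ hh (hy j) fun m hm => ih ?_ fun i => ?_
      · intro i _
        rcases eq_or_ne i j with rfl | hij
        · rw [Function.update_self]
          exact hc i m hm
        · rw [Function.update_of_ne hij]
          exact hyO i trivial
      · rcases eq_or_ne i j with rfl | hij
        · have hms : (m : ℝ) ≤ s := by exact_mod_cast Nat.lt_succ_iff.1 (Finset.mem_range.1 hm)
          rw [Function.update_self, add_sub_cancel_left, abs_of_nonneg (by positivity), mul_comm]
          gcongr
          exact hms.trans hsR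
        · rw [Function.update_of_ne hij]
          exact hy i
    have h2 := hf j y hyO hy
    have h3 : η ≤ Λ ^ (l.length + 1) * η := le_mul_of_one_le_left hη (one_le_pow₀ hΛ1)
    calc |f y - tensorInterp s h c (j :: l) f y|
        ≤ |f y - coordInterp s h c j f y|
          + |coordInterp s h c j f y - coordInterp s h c j (tensorInterp s h c l f) y| :=
          abs_sub_le _ _ _
      _ ≤ Λ ^ (l.length + 1) * η + Λ * (l.length * Λ ^ l.length * η) := by linarith
      _ = ((l.length : ℝ) + 1) * Λ ^ (l.length + 1) * η := by ring
      _ = _ := by rw [List.length_cons]; push_cast; ring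

lemma abs_sub_coordInterp_le {r η : ℝ} (hΛ : ∀ u, |u| ≤ R →
      ∑ m ∈ Finset.range (s + 1), |lagrangeWeight s m u| ≤ Λ) (hh : 0 < h) (hsR : s ≤ R)
    (hc : ∀ j, ∀ m ∈ Finset.range (s + 1), c j + h * m ∈ Set.Ioo (0 : ℝ) 1)
    {f : (Fin D → ℝ) → ℝ} (j : Fin D) (φ : ℕ → ℝ → ℝ) {y : Fin D → ℝ} (hyO : y ∈ openCube D)
    (hy : |y j - c j| ≤ R * h) (hφ0 : ∀ t, φ 0 t = f (Function.update y j t))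
    (hr : r = R * h)
    (hder : ∀ k < s, ∀ t ∈ Set.Ioo (0 : ℝ) 1, HasDerivAt (φ k) (φ (k + 1) t) t)
    (hη : ∀ t ∈ Set.Ioo (0 : ℝ) 1, |t - c j| ≤ r → |φ s t - φ s (c j)| ≤ η) :
    |f y - coordInterp s h c j f y| ≤ (1 + Λ) * (η * r ^ s) := by
  subst hr
  set J := Set.Ioo (0 : ℝ) 1 ∩ Metric.closedBall (c j) (R * h) with hJ
  have hmem : ∀ t, t ∈ J ↔ t ∈ Set.Ioo (0 : ℝ) 1 ∧ |t - c j| ≤ R * h := fun t => by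
    rw [hJ, Set.mem_inter_iff, Metric.mem_closedBall, Real.dist_eq]
  have hR : 0 ≤ R * h := mul_nonneg ((Nat.cast_nonneg s).trans hsR) hh.le
  have ha : c j ∈ J := (hmem _).2 ⟨by simpa using hc j 0 (by simp), by simpa using hR⟩
  obtain ⟨p, hp, hpφ⟩ := exists_polynomial_approx
    ((convex_Ioo 0 1).inter (convex_closedBall _ _)) ha (fun t ht => ((hmem t).1 ht).2) s φ
    (fun k hk t ht => (hder k hk t ((hmem t).1 ht).1).hasDerivWithinAt)
    (fun t ht => hη t ((hmem t).1 ht).1 ((hmem t).1 ht).2)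
  have hy1 := hpφ (y j) ((hmem _).2 ⟨hyO j trivial, hy⟩)
  rw [hφ0, Function.update_eq_self] at hy1
  have h2 := eval_eq_sum_lagrangeWeight hp (c j) h ((y j - c j) / h)
  rw [mul_div_cancel₀ _ hh.ne', add_sub_cancel] at h2
  have h3 : |p.eval (y j) - coordInterp s h c j f y| ≤ Λ * (η * (R * h) ^ s) := by
    rw [h2, coordInterp, ← Finset.sum_sub_distrib]
    simp only [← mul_sub]
    refine (abs_sum_mul_le _ _ _ (η := η * (R * h) ^ s) fun m hm => ?_).trans
      (mul_le_mul_of_nonneg_right (hΛ _ ?_) ((abs_nonneg _).trans hy1))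
    · have hms : (m : ℝ) ≤ s := by exact_mod_cast Nat.lt_succ_iff.1 (Finset.mem_range.1 hm)
      rw [abs_sub_comm, ← hφ0]
      refine hpφ _ ((hmem _).2 ⟨hc j m hm, ?_⟩)
      rw [add_sub_cancel_left, abs_of_nonneg (by positivity), mul_comm]
      gcongr
      exact hms.trans hsR
    · rwa [abs_div, abs_of_pos hh, div_le_iff₀ hh]
  calc |f y - coordInterp s h c j f y|
      ≤ |f y - p.eval (y j)| + |p.eval (y j) - coordInterp s h c j f y| := abs_sub_le _ _ _
    _ ≤ _ := by linarith

end Interpolation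

end

section Holder

variable {D : ℕ} {f : (Fin D → ℝ) → ℝ} {β M : ℝ}

lemma contDiffOn_pderivIter (j : Fin D) (k n : ℕ)
    (hf : ContDiffOn ℝ ((n + k : ℕ) : WithTop ℕ∞) f (openCube D)) :
    ContDiffOn ℝ (n : WithTop ℕ∞) (pderivIter j k f) (openCube D) := by
  induction k generalizing n with
  | zero => exact hf
  | succ k ih =>
    have h := ih (n + 1) (by convert hf using 2; ring)
    have h' := ((contDiffOn_succ_iff_fderiv_of_isOpen (n := (n : WithTop ℕ∞))
      (isOpen_openCube D)).1 (by exact_mod_cast h)).2.2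
    exact h'.clm_apply contDiffOn_const

lemma update_mem_openCube {y : Fin D → ℝ} (hy : y ∈ openCube D) (j : Fin D) {t : ℝ}
    (ht : t ∈ Set.Ioo (0 : ℝ) 1) : Function.update y j t ∈ openCube D := by
  intro i _
  rcases eq_or_ne i j with rfl | hij
  · simpa using ht
  · rw [Function.update_of_ne hij]
    exact hy i trivial

lemma hasDerivAt_pderivIter_update {s k : ℕ} (hf : ContDiffOn ℝ (s : WithTop ℕ∞) f (openCube D))
    (hk : k < s) (j : Fin D) {y : Fin D → ℝ} (hy : y ∈ openCube D) {t : ℝ}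
    (ht : t ∈ Set.Ioo (0 : ℝ) 1) :
    HasDerivAt (fun t => pderivIter j k f (Function.update y j t))
      (pderivIter j (k + 1) f (Function.update y j t)) t := by
  have h1 : ContDiffOn ℝ ((1 : ℕ) : WithTop ℕ∞) (pderivIter j k f) (openCube D) :=
    contDiffOn_pderivIter j k 1 (hf.of_le (by exact_mod_cast (by omega : 1 + k ≤ s)))
  have h2 : DifferentiableAt ℝ (pderivIter j k f) (Function.update y j t) :=
    (h1.differentiableOn (by simp)).differentiableAt
      ((isOpen_openCube D).mem_nhds (update_mem_openCube hy j ht))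
  exact h2.hasFDerivAt.comp_hasDerivAt t (hasDerivAt_update y j t)

lemma foldr_pderivIter_single (j : Fin D) (s : ℕ) (l : List (Fin D)) (hl : l.Nodup) :
    l.foldr (fun i g => pderivIter i ((Pi.single j s : Fin D → ℕ) i) g) f
      = if j ∈ l then pderivIter j s f else f := by
  induction l with
  | nil => simp
  | cons i l ih =>
    rw [List.nodup_cons] at hl
    rw [List.foldr_cons, ih hl.2]
    rcases eq_or_ne i j with rfl | hij
    · simp [hl.1]
    · simp [hij, hij.symm, pderivIter]

lemma mDeriv_single (j : Fin D) (s : ℕ) : mDeriv (Pi.single j s) f = pderivIter j s f := by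
  rw [mDeriv, List.ofFn_eq_map, List.foldr_map,
    foldr_pderivIter_single j s _ (List.nodup_finRange D), if_pos (List.mem_finRange j)]

lemma mDeriv_zero : mDeriv 0 f = f := by
  rw [mDeriv, List.ofFn_eq_map, List.foldr_map]
  induction List.finRange D with
  | nil => rfl
  | cons i l ih => rw [List.foldr_cons, ih]; rfl

lemma hFloor_lt (hβ : 0 < β) : (hFloor β : ℝ) < β := by
  have h1 : 0 < ⌈β⌉₊ := Nat.ceil_pos.2 hβ
  have h2 := Nat.ceil_lt_add_one hβ.le
  rw [hFloor, Nat.cast_sub h1]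
  push_cast
  linarith

lemma norm_update_sub_update (y : Fin D → ℝ) (j : Fin D) (t t' : ℝ) :
    ‖Function.update y j t - Function.update y j t'‖ = |t - t'| := by
  have : Function.update y j t - Function.update y j t' = Pi.single j (t - t') := by
    rw [← Function.update_sub, sub_self]
    rfl
  rw [this, Pi.norm_single, Real.norm_eq_abs]

lemma abs_sub_coordInterp_le_of_mem_holderBall (hβ : 0 < β) (hf : f ∈ holderBall D β M)
    {s : ℕ} (hs : s = hFloor β) {h R Λ : ℝ} {c : Fin D → ℝ} (hΛ : ∀ u, |u| ≤ R →
      ∑ m ∈ Finset.range (s + 1), |lagrangeWeight s m u| ≤ Λ) (hh : 0 < h)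
    (hR : 0 < R) (hsR : s ≤ R)
    (hc : ∀ j, ∀ m ∈ Finset.range (s + 1), c j + h * m ∈ Set.Ioo (0 : ℝ) 1)
    (j : Fin D) {y : Fin D → ℝ} (hyO : y ∈ openCube D) (hy : |y j - c j| ≤ R * h) :
    |f y - coordInterp s h c j f y| ≤ (1 + Λ) * (M * R ^ β) * h ^ β := by
  obtain ⟨hcd, M₁, M₂, hM₁, hM₂, hM, -, hhol⟩ := hf
  rw [← hs] at hhol hcd
  have hcd' : ContDiffOn ℝ (s : WithTop ℕ∞) f (openCube D) :=
    ContDiffOn.mono (by exact_mod_cast hcd) (openCube_subset_unitCube D)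
  have hγ : 0 < β - s := by
    rw [hs]
    linarith [hFloor_lt hβ]
  have hcj : c j ∈ Set.Ioo (0 : ℝ) 1 := by simpa using hc j 0 (by simp)
  have key := abs_sub_coordInterp_le (η := M * (R * h) ^ (β - s)) hΛ hh hsR hc j
    (fun k t => pderivIter j k f (Function.update y j t)) hyO hy (fun t => rfl) rfl
    (fun k hk t ht => hasDerivAt_pderivIter_update hcd' hk j hyO ht) (by
      intro t ht htr
      rcases eq_or_ne t (c j) with rfl | hne
      · rw [sub_self, abs_zero]
        have : 0 ≤ M := by linarith
        positivity
      · have h1 := hhol (Pi.single j s) (by simp)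
          (Function.update y j t) (openCube_subset_unitCube D (update_mem_openCube hyO j ht))
          (Function.update y j (c j)) (openCube_subset_unitCube D (update_mem_openCube hyO j hcj))
          (fun h => hne (Function.update_injective y j h))
        rw [mDeriv_single, norm_update_sub_update] at h1
        refine h1.trans ?_
        exact mul_le_mul (by linarith) (Real.rpow_le_rpow (abs_nonneg _) htr hγ.le)
          (by positivity) (by linarith))
  refine key.trans (le_of_eq ?_)
  have : (R * h) ^ (β - s) * (R * h) ^ s = R ^ β * h ^ β := by
    rw [← Real.rpow_natCast, ← Real.rpow_add (by positivity), sub_add_cancel,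
      Real.mul_rpow hR.le hh.le]
  rw [mul_assoc M, this]
  ring

lemma abs_le_of_mem_holderBall (hs : 0 < hFloor β) (hf : f ∈ holderBall D β M) {x : Fin D → ℝ}
    (hx : x ∈ unitCube D) : |f x| ≤ M := by
  obtain ⟨-, M₁, M₂, hM₁, hM₂, hM, hbd, -⟩ := hf
  have := hbd 0 (by simpa using hs) x hx
  rw [mDeriv_zero] at this
  linarith

lemma const_mem_holderBall (hM : 0 ≤ M) (hs : hFloor β = 0) (a : ℝ) :
    (fun _ => a) ∈ holderBall D β M := by
  refine ⟨contDiffOn_const, 0, 0, le_rfl, le_rfl, by simpa using hM, by simp [hs], ?_⟩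
  intro α hα x _ y _ _
  have : α = 0 := by
    ext j
    exact (Finset.sum_eq_zero_iff.1 (hα.trans hs)) j (Finset.mem_univ j)
  rw [this, mDeriv_zero]
  simp

end Holder

section FunCover

variable {D : ℕ} {μ : Measure (Fin D → ℝ)}

lemma funCoverNum_le_card {F : Set ((Fin D → ℝ) → ℝ)} {ε : ℝ} {κ : Type} [Fintype κ]
    (code : F → κ) (hcode : ∀ f f' : F, code f = code f' → ∀ᵐ x ∂μ, |f.1 x - f'.1 x| ≤ ε) :
    funCoverNum ε F μ ≤ Fintype.card κ := by
  classical
  let rep : κ → (Fin D → ℝ) → ℝ := fun k => if h : ∃ f, code f = k then h.choose.1 else 0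
  have hmem : (Finset.univ.image rep).card ∈ {n : ℕ | ∃ s : Finset ((Fin D → ℝ) → ℝ),
      s.card = n ∧ ∀ f ∈ F, ∃ g ∈ s, ∀ᵐ x ∂μ, |f x - g x| ≤ ε} := by
    refine ⟨_, rfl, fun f hf => ⟨rep (code ⟨f, hf⟩), by simp, ?_⟩⟩
    have h : ∃ f', code f' = code ⟨f, hf⟩ := ⟨_, rfl⟩
    simp only [rep, dif_pos h]
    exact hcode ⟨f, hf⟩ _ h.choose_spec.symm
  exact (Nat.sInf_le hmem).trans (Finset.card_image_le.trans_eq Finset.card_univ)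

lemma funCoverNum_eq_zero_of_const_mem [IsProbabilityMeasure μ] {F : Set ((Fin D → ℝ) → ℝ)}
    (hF : ∀ a : ℝ, (fun _ => a) ∈ F) {ε : ℝ} (hε : 0 < ε) : funCoverNum ε F μ = 0 := by
  rw [funCoverNum, Nat.sInf_eq_zero]
  refine Or.inr (Set.eq_empty_iff_forall_notMem.2 ?_)
  rintro n ⟨s, -, hs⟩
  choose G hGs hG using fun k : ℕ => hs (fun _ => 3 * ε * k) (hF _)
  refine not_injective_infinite_finite (fun k => (⟨G k, hGs k⟩ : s)) fun k l hkl => ?_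
  have hkl' : G k = G l := congrArg Subtype.val hkl
  obtain ⟨x, hx, hx'⟩ := ((hG k).and (hG l)).exists
  rw [hkl'] at hx
  have h1 : |3 * ε * k - 3 * ε * l| ≤ ε + ε :=
    (abs_sub_le _ (G l x) _).trans (add_le_add hx (by rwa [abs_sub_comm]))
  rw [← mul_sub, abs_mul, abs_of_pos (by positivity)] at h1
  have h2 : |((k : ℤ) - l : ℝ)| < 1 := by
    push_cast
    nlinarith
  have h3 : |(k : ℤ) - l| < 1 := by exact_mod_cast h2
  rw [Int.abs_lt_one_iff] at h3
  omega

lemma ae_mem_measSupport : ∀ᵐ x ∂μ, x ∈ measSupport μ := by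
  have : measSupport μ = μ.support := Set.ext fun x => (Measure.mem_support_iff_forall x).symm
  rw [this]
  exact Measure.support_mem_ae

end FunCover

section Anchor

variable {D : ℕ}

/-- A point of the open cube close to `x` from which a grid of mesh `h` with `s + 1` nodes in
each direction stays in the open cube. -/
noncomputable def gridAnchor (s : ℕ) (h : ℝ) (x : Fin D → ℝ) (j : Fin D) : ℝ :=
  h + (1 - (s + 2) * h) * (Set.projIcc (0 : ℝ) 1 zero_le_one (x j) : ℝ)

variable {s : ℕ} {h : ℝ}

lemma gridAnchor_add_mem_Ioo (hh : 0 < h) (hs : (s + 2) * h ≤ 1) (x : Fin D → ℝ) (j : Fin D)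
    {m : ℕ} (hm : m ∈ Finset.range (s + 1)) :
    gridAnchor s h x j + h * m ∈ Set.Ioo (0 : ℝ) 1 := by
  have hms : (m : ℝ) ≤ s := by exact_mod_cast Nat.lt_succ_iff.1 (Finset.mem_range.1 hm)
  obtain ⟨h0, h1⟩ := (Set.projIcc (0 : ℝ) 1 zero_le_one (x j)).2
  have h2 : 0 ≤ h * m := by positivity
  have h3 : h * m ≤ h * s := by gcongr
  have h4 : 0 ≤ 1 - (s + 2) * h := by linarith
  have h5 := mul_nonneg h4 h0
  have h6 := mul_le_mul_of_nonneg_left h1 h4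
  rw [gridAnchor]
  constructor <;> nlinarith

lemma abs_gridAnchor_sub_le (hh : 0 < h) (hs : (s + 2) * h ≤ 1) (x y : Fin D → ℝ) (j : Fin D) :
    |gridAnchor s h x j - gridAnchor s h y j| ≤ |x j - y j| := by
  have h1 := Set.abs_projIcc_sub_projIcc (c := x j) (d := y j) (zero_le_one' ℝ)
  have h2 : (0 : ℝ) ≤ (s + 2) * h := by positivity
  rw [gridAnchor, gridAnchor, add_sub_add_left_eq_sub, ← mul_sub, abs_mul,
    abs_of_nonneg (by linarith)]
  exact (mul_le_of_le_one_left (abs_nonneg _) (by linarith)).trans h1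

lemma abs_sub_gridAnchor_self_le (hh : 0 < h) {x : Fin D → ℝ} (hx : x ∈ unitCube D) (j : Fin D) :
    |x j - gridAnchor s h x j| ≤ (s + 2) * h := by
  obtain ⟨h0, h1⟩ := hx j trivial
  have h2 : (0 : ℝ) ≤ s * h := by positivity
  rw [gridAnchor, Set.projIcc_of_mem _ (hx j trivial), abs_le]
  constructor <;> nlinarith

end Anchor

/-- A bound on the covering number of the Hölder ball in terms of a cover of the support whose
centers are partitioned into `U` chain-connected groups. -/
lemma exists_funCoverNum_holderBall_le {D : ℕ} {β M : ℝ} (hβ : 0 < β) (hM : 0 < M)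
    (hs : 0 < hFloor β) :
    ∃ (A h₀ : ℝ) (N B : ℕ), 0 < A ∧ 0 < h₀ ∧ ∀ μ : Measure (Fin D → ℝ), IsProbabilityMeasure μ →
      μ (unitCube D) = 1 → ∀ h ∈ Set.Ioo 0 h₀, ∀ (T U : ℕ) (x : Fin T → (Fin D → ℝ))
      (g : Fin T → Fin U), measSupport μ ⊆ ⋃ i, Metric.closedBall (x i) h →
      (∀ j : Fin U, ∀ X : Finset (Fin T), (∀ i ∈ X, g i = j) → X.Nonempty →
        X ≠ Finset.univ.filter (fun i => g i = j) →
        ∃ i, g i = j ∧ i ∉ X ∧ ∃ k ∈ X, ‖x k - x i‖ ≤ h) →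
      funCoverNum (A * h ^ β) (holderBall D β M) μ ≤
        ((2 * ⌈M / h ^ β + 1⌉₊ + 1) ^ N) ^ U * ((2 * B + 1) ^ N) ^ T := by
  obtain ⟨s, hs'⟩ : ∃ s, s = hFloor β := ⟨_, rfl⟩
  obtain ⟨Λ, hΛ1, hΛ⟩ := exists_sum_abs_lagrangeWeight_le s ((s : ℝ) + 4)
  set R : ℝ := (s : ℝ) + 4 with hR
  have hR0 : 0 < R := by positivity
  have hsR : (s : ℝ) ≤ R := by linarith
  set K : ℝ := D * Λ ^ D * ((1 + Λ) * (M * R ^ β)) with hK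
  have hΛ0 : 0 < Λ := by linarith
  have hK0 : 0 ≤ K := by positivity
  refine ⟨Λ ^ D + 2 * K, 1 / (s + 2), Fintype.card (Fin D → Fin (s + 1)), ⌈Λ ^ D + K + 2⌉₊,
    by positivity, by positivity, ?_⟩
  intro μ _ hcube h ⟨hh, hh₀⟩ T U x g hcov hconn
  have hsh : (s + 2) * h ≤ 1 := by
    rw [lt_div_iff₀ (by positivity)] at hh₀
    linarith
  let c : Fin T → Fin D → ℝ := fun i => gridAnchor s h (x i)
  let near : Fin T → (Fin D → ℝ) → Prop := fun i y =>
    y ∈ openCube D ∧ ∀ j, |y j - c i j| ≤ R * h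
  have hcm : ∀ i j, ∀ m ∈ Finset.range (s + 1), c i j + h * m ∈ Set.Ioo (0 : ℝ) 1 :=
    fun i j m hm => gridAnchor_add_mem_Ioo hh hsh (x i) j hm
  have hmr : ∀ m : Fin (s + 1), (m : ℕ) ∈ Finset.range (s + 1) := fun m => Finset.mem_range.2 m.2
  have hzO : ∀ (i : Fin T) (m : Fin D → Fin (s + 1)),
      (fun j => c i j + h * (m j : ℕ)) ∈ openCube D := fun i m j _ => hcm i j _ (hmr _)
  have hlen : (List.finRange D).length = D := List.length_finRange
  have hq : 0 < h ^ β := Real.rpow_pos_of_pos hh β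
  obtain ⟨κ, inst, code, hcard, hcode⟩ := exists_code_of_local_prediction (holderBall D β M) g
    (fun k i => ‖x k - x i‖ ≤ h) hconn (fun i (m : Fin D → Fin (s + 1)) j => c i j + h * (m j : ℕ))
    (fun i => tensorInterp s h (c i) (List.finRange D)) near (h ^ β) (Λ ^ D) K hq
    ⌈M / h ^ β + 1⌉₊ ⌈Λ ^ D + K + 2⌉₊
    (by
      intro f hf i m
      refine le_trans ?_ (Nat.le_ceil _)
      gcongr
      exact abs_le_of_mem_holderBall hs hf (openCube_subset_unitCube D (hzO i m)))
    (Nat.le_ceil _)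
    (by
      intro i y hy f f' η hη
      have := abs_tensorInterp_sub_le hΛ hh hsR (List.finRange D) hy.2 (F := f) (G := f') (η := η)
        (by
          intro y' hy' _
          choose m hm hm' using fun j => hy' j (List.mem_finRange j)
          have h1 := hη fun j => ⟨m j, Finset.mem_range.1 (hm j)⟩
          rwa [← show y' = fun j => c i j + h * (m j : ℝ) from funext hm'] at h1)
      rwa [hlen] at this)
    (by
      intro f hf i y hy
      have := abs_sub_tensorInterp_le hΛ hΛ1 hh hsR (hcm i)
        (η := (1 + Λ) * (M * R ^ β) * h ^ β) (by positivity)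
        (fun j y hyO hy => abs_sub_coordInterp_le_of_mem_holderBall hβ hf hs' hΛ hh hR0 hsR
          (hcm i) j hyO (hy j)) (List.finRange D) hy.1 hy.2
      rw [hlen] at this
      exact this.trans_eq (by rw [hK]; ring))
    (by
      intro k i hki m
      refine ⟨hzO i m, fun j => ?_⟩
      have hki' : ‖x i - x k‖ ≤ h := by rwa [norm_sub_rev]
      have h1 := (abs_gridAnchor_sub_le hh hsh (x i) (x k) j).trans
        ((norm_le_pi_norm (x i - x k) j).trans hki')
      have hm : ((m j : ℕ) : ℝ) ≤ s := by exact_mod_cast Nat.lt_succ_iff.1 (m j).2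
      have h2 : h * ((m j : ℕ) : ℝ) ≤ h * s := by gcongr
      have h3 : 0 ≤ h * ((m j : ℕ) : ℝ) := by positivity
      have h4 := abs_le.1 h1
      simp only [c]
      rw [abs_le, hR]
      constructor <;> nlinarith [h4.1, h4.2])
  refine (funCoverNum_le_card code fun f f' hff' => ?_).trans hcard
  have hcube' : ∀ᵐ y ∂μ, y ∈ unitCube D := by
    have hmeas : MeasurableSet (unitCube D) := MeasurableSet.univ_pi fun _ => measurableSet_Icc
    exact mem_ae_iff.2 ((prob_compl_eq_zero_iff hmeas).2 hcube)
  filter_upwards [hcube', ae_mem_measSupport] with y hyc hys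
  obtain ⟨i, hi⟩ := Set.mem_iUnion.1 (hcov hys)
  have hyi : ∀ j, |y j - c i j| < R * h := by
    intro j
    have h1 := abs_sub_gridAnchor_self_le (s := s) hh hyc j
    have h2 := (abs_gridAnchor_sub_le hh hsh y (x i) j).trans
      ((norm_le_pi_norm (y - x i) j).trans (mem_closedBall_iff_norm.1 hi))
    have h3 := abs_sub_le (y j) (gridAnchor s h y j) (c i j)
    rw [hR]
    nlinarith
  let V : Set (Fin D → ℝ) := Set.univ.pi fun j => Metric.ball (c i j) (R * h)
  have hV : IsOpen V := isOpen_set_pi Set.finite_univ fun _ _ => Metric.isOpen_ball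
  have hyV : y ∈ closure (V ∩ openCube D) :=
    hV.inter_closure ⟨fun j _ => by simpa [Real.dist_eq] using hyi j, by rwa [closure_openCube]⟩
  have hcont : ContinuousOn (fun y => |f.1 y - f'.1 y|) (unitCube D) :=
    (f.2.1.continuousOn.sub f'.2.1.continuousOn).abs
  have hcl : closure (V ∩ openCube D) ⊆ unitCube D :=
    (closure_mono Set.inter_subset_right).trans_eq (closure_openCube D)
  refine le_on_closure (s := V ∩ openCube D) (f := fun y => |f.1 y - f'.1 y|)
    (g := fun _ => (Λ ^ D + 2 * K) * h ^ β) (fun z hz => ?_) (hcont.mono hcl)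
    continuousOn_const hyV
  refine hcode f f' hff' i z ⟨hz.2, fun j => ?_⟩
  have := hz.1 j trivial
  rw [Metric.mem_ball, Real.dist_eq] at this
  exact this.le

/-- Upper bound on the metric entropy of the Hölder ball under the
Concentration Condition. -/
theorem holder_entropy_upper_bound
    (D : ℕ) (d β M : ℝ) (hβ : 0 < β) (hM : 0 < M) (hd : 0 < d)
    (μ : MeasureTheory.Measure (Fin D → ℝ)) [MeasureTheory.IsProbabilityMeasure μ]
    (hcube : μ (unitCube D) = 1)
    (C : ℝ) (hC : 0 < C) (ε₁ : ℝ) (hε₁ : 0 < ε₁)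
    (hN : ∀ ε ∈ Set.Ioo (0:ℝ) ε₁, (coverNum (measSupport μ) ε : ℝ) ≤ C * ε ^ (-d))
    (hCC : ConcentrationCondition (measSupport μ)) :
    ∃ C' ε₀ : ℝ, 0 < C' ∧ 0 < ε₀ ∧ ∀ ε ∈ Set.Ioo (0:ℝ) ε₀,
      Real.log (funCoverNum ε (holderBall D β M) μ) ≤ C' * ε ^ (-(d / β)) := by
  rcases Nat.eq_zero_or_pos (hFloor β) with hs | hs
  · refine ⟨1, 1, one_pos, one_pos, fun ε hε => ?_⟩
    rw [funCoverNum_eq_zero_of_const_mem (const_mem_holderBall hM.le hs) hε.1]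
    simpa using Real.rpow_nonneg hε.1.le _
  obtain ⟨A, h₀, N, B, hA, hh₀, hcover⟩ := exists_funCoverNum_holderBall_le (D := D) hβ hM hs
  obtain ⟨C₁, C₂, hC₁, hC₂, hCC⟩ := hCC
  set a : ℝ := N * (Real.log (2 * M + 5) + β) with ha
  set b : ℝ := N * Real.log (2 * B + 1) with hb
  have hlogM : 0 ≤ Real.log (2 * M + 5) := Real.log_nonneg (by linarith)
  have ha0 : 0 ≤ a := by positivity
  have hB1 : (1 : ℝ) ≤ 2 * B + 1 := by linarith [Nat.cast_nonneg (α := ℝ) B]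
  have hb0 : 0 ≤ b := mul_nonneg (Nat.cast_nonneg _) (Real.log_nonneg hB1)
  set h₁ : ℝ := min (min h₀ ε₁) (Real.exp (-1)) with hh₁
  have hh₁0 : 0 < h₁ := lt_min (lt_min hh₀ hε₁) (Real.exp_pos _)
  refine ⟨(a * C₂ + b * C₁) * C * A ^ (d / β) + 1, A * h₁ ^ β, by positivity, by positivity,
    fun ε ⟨hε, hε'⟩ => ?_⟩
  set h : ℝ := (ε / A) ^ (1 / β) with hh
  have hεA : 0 < ε / A := by positivity
  have hh0 : 0 < h := Real.rpow_pos_of_pos hεA _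
  have hhβ : h ^ β = ε / A := by
    rw [hh, ← Real.rpow_mul hεA.le, one_div_mul_cancel hβ.ne', Real.rpow_one]
  have hlt : h < h₁ := by
    rw [← Real.rpow_lt_rpow_iff hh0.le hh₁0.le hβ, hhβ, div_lt_iff₀ hA]
    linarith
  have hlt₀ : h < h₀ := hlt.trans_le ((min_le_left _ _).trans (min_le_left _ _))
  have hlt₁ : h < ε₁ := hlt.trans_le ((min_le_left _ _).trans (min_le_right _ _))
  have hlte : h < Real.exp (-1) := hlt.trans_le (min_le_right _ _)
  have hL : 1 ≤ Real.log (1 / h) := by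
    rw [one_div, Real.log_inv, le_neg]
    simpa using Real.log_le_log hh0 hlte.le
  have hh1 : h ≤ 1 := hlte.le.trans (by simp)
  obtain ⟨T, U, x, g, hcov, hconn, hT, hU⟩ := hCC h hh0
  have hcount := hcover μ inferInstance hcube h ⟨hh0, hlt₀⟩ T U x g hcov hconn
  rw [hhβ, mul_div_cancel₀ _ hA.ne', ← hhβ] at hcount
  have hNh := hN h ⟨hh0, hlt₁⟩
  have hq : 0 < h ^ β := Real.rpow_pos_of_pos hh0 β
  have hq1 : h ^ β ≤ 1 := Real.rpow_le_one hh0.le hh1 hβ.le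
  have hroot : Real.log (2 * ⌈M / h ^ β + 1⌉₊ + 1) ≤
      (Real.log (2 * M + 5) + β) * Real.log (1 / h) := by
    have h1 : (⌈M / h ^ β + 1⌉₊ : ℝ) ≤ M / h ^ β + 1 + 1 :=
      (Nat.ceil_lt_add_one (by positivity)).le
    have h2 : (2 * ⌈M / h ^ β + 1⌉₊ + 1 : ℝ) ≤ (2 * M + 5) / h ^ β := by
      have : 1 ≤ 1 / h ^ β := by rwa [le_div_iff₀ hq, one_mul]
      calc (2 * ⌈M / h ^ β + 1⌉₊ + 1 : ℝ) ≤ 2 * (M / h ^ β) + 5 * (1 / h ^ β) := by linarith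
        _ = _ := by ring
    calc Real.log (2 * ⌈M / h ^ β + 1⌉₊ + 1) ≤ Real.log ((2 * M + 5) / h ^ β) :=
          Real.log_le_log (by positivity) h2
      _ = Real.log (2 * M + 5) + β * Real.log (1 / h) := by
          rw [Real.log_div (by positivity) hq.ne', Real.log_rpow hh0, one_div, Real.log_inv]
          ring
      _ ≤ _ := by nlinarith
  have hlog : Real.log (funCoverNum ε (holderBall D β M) μ) ≤
      U * (N * Real.log (2 * ⌈M / h ^ β + 1⌉₊ + 1)) + T * b := by
    have hpos : (0 : ℝ) < ((2 * ⌈M / h ^ β + 1⌉₊ + 1) ^ N) ^ U := by positivity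
    have hpos' : (0 : ℝ) < ((2 * B + 1) ^ N) ^ T := by positivity
    rw [hb, ← Real.log_pow, ← Real.log_pow, ← Real.log_pow, ← Real.log_pow,
      ← Real.log_mul hpos.ne' hpos'.ne']
    rcases Nat.eq_zero_or_pos (funCoverNum ε (holderBall D β M) μ) with h0 | h0
    · rw [h0, Nat.cast_zero, Real.log_zero]
      refine Real.log_nonneg ?_
      refine one_le_mul_of_one_le_of_one_le (one_le_pow₀ (one_le_pow₀ ?_))
        (one_le_pow₀ (one_le_pow₀ hB1))
      linarith [Nat.cast_nonneg (α := ℝ) ⌈M / h ^ β + 1⌉₊]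
    · exact Real.log_le_log (by exact_mod_cast h0) (by exact_mod_cast hcount)
  have hpow : h ^ (-d) = A ^ (d / β) * ε ^ (-(d / β)) := by
    rw [hh, ← Real.rpow_mul hεA.le, show 1 / β * -d = -(d / β) by ring,
      Real.div_rpow hε.le hA.le, Real.rpow_neg hA.le, div_inv_eq_mul, mul_comm]
  have hεpos : 0 ≤ ε ^ (-(d / β)) := Real.rpow_nonneg hε.le _
  calc Real.log (funCoverNum ε (holderBall D β M) μ)
      ≤ U * (N * Real.log (2 * ⌈M / h ^ β + 1⌉₊ + 1)) + T * b := hlog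
    _ ≤ U * (N * ((Real.log (2 * M + 5) + β) * Real.log (1 / h))) + T * b := by gcongr
    _ = a * (U * Real.log (1 / h)) + b * T := by rw [ha]; ring
    _ ≤ a * (C₂ * coverNum (measSupport μ) h) + b * (C₁ * coverNum (measSupport μ) h) := by
        gcongr
    _ = (a * C₂ + b * C₁) * coverNum (measSupport μ) h := by ring
    _ ≤ (a * C₂ + b * C₁) * (C * h ^ (-d)) := by gcongr
    _ = ((a * C₂ + b * C₁) * C * A ^ (d / β)) * ε ^ (-(d / β)) := by rw [hpow]; ring
    _ ≤ _ := by gcongr; linarith
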